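/- Let T be a finite tree (a connected, acyclic simple graph) on d ≥ 1 vertices and let v be a vertex of T. Then there exists a bijective labelling of the vertices of T by {1,…,d} in which v is labelled d such that the resulting labelled graph is (e)-positive, if and only if T is a path with v as one of its endpoints, i.e., there is a graph isomorphism from T to the path P_d that maps v to the vertex d of P_d. -/

import Mathlib

open scoped Classical
noncomputable section

/-- Words of length `d` in the positive integers. -/
abbrev NCWord (d : ℕ) := Fin d → ℕ+

/-- `M_d`: coefficient functions of homogeneous degree-`d` series in
noncommuting variables. -/
abbrev Md (d : ℕ) := NCWord d → ℚ

/-- `Y_G`, the chromatic symmetric function of a labelled graph in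
noncommuting variables, as an element of `M_d`. -/
def YG {d : ℕ} (G : SimpleGraph (Fin d)) : Md d :=
  fun w => if ∀ j k : Fin d, G.Adj j k → w j ≠ w k then 1 else 0

/-- Set partitions of `{0, …, d-1}`. -/
abbrev SetPtn (d : ℕ) := Finpartition (Finset.univ : Finset (Fin d))

/-- `j` and `k` lie in a common block of `π`. -/
def sameBlock {d : ℕ} (π : SetPtn d) (j k : Fin d) : Prop :=
  ∃ B ∈ π.parts, j ∈ B ∧ k ∈ B

/-- The elementary symmetric function `e_π` in noncommuting variables. -/
def eSP {d : ℕ} (π : SetPtn d) : Md d :=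
  fun w => if ∀ j k : Fin d, j ≠ k → sameBlock π j k → w j ≠ w k then 1 else 0

/-- The block of `π` containing `a`. -/
def blockOf {d : ℕ} (π : SetPtn d) (a : Fin d) : Finset (Fin d) :=
  Finset.univ.filter fun k => sameBlock π a k

/-- The type of a set partition relative to the distinguished element `a`:
the multiset of sizes of the blocks not containing `a` (an integer partition),
together with the size of the block containing `a`. -/
def ptype {d : ℕ} (π : SetPtn d) (a : Fin d) : Multiset ℕ × ℕ :=
  ((π.parts.erase (blockOf π a)).val.map Finset.card, (blockOf π a).card)

/-- `K_d`: the span of the differences `e_{π₁} - e_{π₂}` over pairs of set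
partitions of equal type (relative to the distinguished element `a`). -/
def Ksub {d : ℕ} (a : Fin d) : Submodule ℚ (Md d) :=
  Submodule.span ℚ
    {f | ∃ π₁ π₂ : SetPtn d, ptype π₁ a = ptype π₂ a ∧ f = eSP π₁ - eSP π₂}

/-- `(e)`-positivity of a labelled graph, with distinguished vertex `a`:
`Y_G` is congruent modulo `K_d` to a nonnegative combination of `e_π`'s. -/
def IsEPosNCAt {d : ℕ} (G : SimpleGraph (Fin d)) (a : Fin d) : Prop :=
  ∃ (s : Finset (SetPtn d)) (c : SetPtn d → ℚ),
    (∀ π, 0 ≤ c π) ∧ YG G - ∑ π ∈ s, c π • eSP π ∈ Ksub a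

/-- Induction `↑ : M_d → M_{d+1}`. -/
def induct {d : ℕ} (f : Md d) : Md (d + 1) :=
  fun w => if w (Fin.last d) = w ⟨d - 1, by omega⟩
    then f (fun t => w t.castSucc) else 0

/-- Concatenation of labelled graphs: identify the last vertex of `G` with
the first vertex of `H`. -/
def concatG {p q : ℕ} (G : SimpleGraph (Fin p)) (H : SimpleGraph (Fin q)) :
    SimpleGraph (Fin (p + q - 1)) :=
  SimpleGraph.fromRel fun a b =>
    (∃ i j : Fin p, G.Adj i j ∧ (a : ℕ) = (i : ℕ) ∧ (b : ℕ) = (j : ℕ)) ∨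
    (∃ i j : Fin q, H.Adj i j ∧ (a : ℕ) = (i : ℕ) + (p - 1) ∧ (b : ℕ) = (j : ℕ) + (p - 1))

/-- The reverse graph `G^r`. -/
def revG {d : ℕ} (G : SimpleGraph (Fin d)) : SimpleGraph (Fin d) :=
  SimpleGraph.comap (fun i : Fin d => (⟨d - 1 - (i : ℕ), by have := i.isLt; omega⟩ : Fin d)) G

/-- A labelled graph: a simple graph on vertex set `{0, …, n-1}`, `n ≥ 1`. -/
structure LGraph where
  n : ℕ
  npos : 0 < n
  G : SimpleGraph (Fin n)

/-- The last vertex of a labelled graph. -/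
def LGraph.last (A : LGraph) : Fin A.n := ⟨A.n - 1, by have := A.npos; omega⟩

/-- A labelled graph is `(e)`-positive (at its last vertex). -/
def LGraph.EPosNC (A : LGraph) : Prop := IsEPosNCAt A.G A.last

/-- Concatenation, as an operation on labelled graphs. -/
def LGraph.concat (A B : LGraph) : LGraph :=
  ⟨A.n + B.n - 1, by have := A.npos; have := B.npos; omega, concatG A.G B.G⟩

/-- Reversal, as an operation on labelled graphs. -/
def LGraph.rev (A : LGraph) : LGraph := ⟨A.n, A.npos, revG A.G⟩

/-- Appendable `(e)`-positivity: `G + H` is `(e)`-positive for every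
`(e)`-positive labelled graph `G`. -/
def LGraph.Appendable (H : LGraph) : Prop :=
  ∀ A : LGraph, A.EPosNC → (A.concat H).EPosNC

/-- The chromatic symmetric polynomial of `G` in `n` commuting variables. -/
def cspoly {V : Type} [Fintype V] [DecidableEq V] (G : SimpleGraph V) (n : ℕ) :
    MvPolynomial (Fin n) ℚ :=
  ∑ κ ∈ Finset.univ.filter (fun κ : V → Fin n => ∀ u v : V, G.Adj u v → κ u ≠ κ v),
    ∏ v : V, MvPolynomial.X (κ v)

/-- `e`-positivity of a finite graph. -/
def EPos {V : Type} [Fintype V] [DecidableEq V] (G : SimpleGraph V) : Prop :=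
  ∃ c : Nat.Partition (Fintype.card V) → ℚ, (∀ p, 0 ≤ c p) ∧
    ∀ n : ℕ, cspoly G n =
      ∑ p : Nat.Partition (Fintype.card V),
        c p • (p.parts.map fun r => MvPolynomial.esymm (Fin n) ℚ r).prod

/-- Closed neighbourhood of a vertex, as a finset. -/
def closedNbhd {d : ℕ} (G : SimpleGraph (Fin d)) (i : Fin d) : Finset (Fin d) :=
  Finset.univ.filter fun k => k = i ∨ G.Adj i k

/-- `m_i`: the largest label in the closed neighbourhood of `i`. -/
def mIdx {d : ℕ} (G : SimpleGraph (Fin d)) (i : Fin d) : Fin d :=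
  (closedNbhd G i).max' ⟨i, by simp [closedNbhd]⟩

/-- `w_i`: the smallest label in the closed neighbourhood of `i`. -/
def wIdx {d : ℕ} (G : SimpleGraph (Fin d)) (i : Fin d) : Fin d :=
  (closedNbhd G i).min' ⟨i, by simp [closedNbhd]⟩

/-- Labelled unit interval graph. -/
def IsUnitInterval {d : ℕ} (G : SimpleGraph (Fin d)) : Prop :=
  ∀ i v w j : Fin d, i ≤ v → v < w → w ≤ j → G.Adj i j → G.Adj v w

/-- An acyclic orientation of a graph, as an asymmetric relation with
irreflexive transitive closure whose symmetrization matches adjacency. -/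
def IsAcyclicOrientation {V : Type} (G : SimpleGraph V) (r : V → V → Prop) : Prop :=
  (∀ a b, r a b → ¬ r b a) ∧
  (∀ a b, a ≠ b → ((r a b ∨ r b a) ↔ G.Adj a b)) ∧
  Irreflexive (Relation.TransGen r)

/-- The set of sinks of an orientation. -/
def sinkSet {V : Type} [Fintype V] (r : V → V → Prop) : Finset V :=
  Finset.univ.filter fun x => ∀ y, ¬ r x y

/-- The labelled path `P_d`. -/
def PathG (d : ℕ) : SimpleGraph (Fin d) :=
  SimpleGraph.fromRel fun a b => (b : ℕ) = (a : ℕ) + 1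

/-- The labelled cycle `C_d`. -/
def CycleG (d : ℕ) : SimpleGraph (Fin d) :=
  SimpleGraph.fromRel fun a b => (b : ℕ) = (a : ℕ) + 1 ∨ ((a : ℕ) = 0 ∧ (b : ℕ) = d - 1)

open Finset

variable {d : ℕ}

instance : Finite (Setoid (Fin d)) :=
  Finite.of_injective (fun r : Setoid (Fin d) => fun x y => r x y) fun r s h => by
    ext x y
    exact iff_of_eq (congrFun (congrFun h x) y)

instance : Fintype (Setoid (Fin d)) := Fintype.ofFinite _

instance : LocallyFiniteOrder (Setoid (Fin d)) := Fintype.toLocallyFiniteOrder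

/-- The indicator of the words that are injective on every class of `r`. -/
def eRel (r : Setoid (Fin d)) : Md d :=
  fun w => if r ⊓ Setoid.ker w = ⊥ then 1 else 0

/-- The power sum of `r`: the indicator of the words that are constant on every class of `r`. -/
def pRel (r : Setoid (Fin d)) : Md d :=
  fun w => if r ≤ Setoid.ker w then 1 else 0

/-- The Möbius function `μ(⊥, r)` of the partition lattice. -/
def mobBot (r : Setoid (Fin d)) : ℚ := IncidenceAlgebra.mu ℚ ⊥ r

/-- A word whose kernel is `r`. -/
def kerWord (r : Setoid (Fin d)) : NCWord d :=
  fun i => Nat.succPNat (Quotient.out (Quotient.mk r i) : Fin d).val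

lemma ker_kerWord (r : Setoid (Fin d)) : Setoid.ker (kerWord r) = r := by
  ext x y
  simp only [Setoid.ker_def, kerWord, Nat.succPNat_inj, Fin.val_inj, Quotient.out_inj]
  exact Quotient.eq

/-- The coefficient of `pRel r`, as a functional on `M_d`. -/
def pCoeff (r : Setoid (Fin d)) : Md d →ₗ[ℚ] ℚ :=
  ∑ t ∈ Icc ⊥ r, IncidenceAlgebra.mu ℚ t r • LinearMap.proj (kerWord t)

lemma pCoeff_apply (r : Setoid (Fin d)) (f : Md d) :
    pCoeff r f = ∑ t ∈ Icc ⊥ r, IncidenceAlgebra.mu ℚ t r * f (kerWord t) := by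
  simp [pCoeff, LinearMap.sum_apply]

lemma pCoeff_pRel (r s : Setoid (Fin d)) : pCoeff r (pRel s) = if s = r then 1 else 0 := by
  rw [← IncidenceAlgebra.sum_Icc_mu_left (𝕜 := ℚ) s r, pCoeff_apply]
  simp only [pRel, ker_kerWord, mul_ite, mul_one, mul_zero]
  rw [← Finset.sum_filter]
  refine Finset.sum_congr ?_ fun _ _ => rfl
  ext t
  simp [and_comm]

lemma eRel_eq_sum (r : Setoid (Fin d)) :
    eRel r = ∑ s ∈ Icc ⊥ r, mobBot s • pRel s := by
  ext w
  have h := IncidenceAlgebra.sum_Icc_mu_right (𝕜 := ℚ) ⊥ (r ⊓ Setoid.ker w)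
  simp only [eRel, pRel, Finset.sum_apply, Pi.smul_apply, smul_eq_mul, mul_ite, mul_one, mul_zero]
  rw [← Finset.sum_filter]
  rw [eq_comm, if_congr eq_comm rfl rfl, ← h]
  refine Finset.sum_congr ?_ fun _ _ => rfl
  ext t
  simp

lemma pCoeff_eRel (r s : Setoid (Fin d)) :
    pCoeff r (eRel s) = if r ≤ s then mobBot r else 0 := by
  simp [eRel_eq_sum, map_sum, pCoeff_pRel]

/-- The setoid relating only `x` and `y`. -/
def pairSetoid (x y : Fin d) : Setoid (Fin d) where
  r u v := u = v ∨ (u = x ∧ v = y) ∨ (u = y ∧ v = x)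
  iseqv := ⟨fun _ => Or.inl rfl, by grind, by grind⟩

lemma pairSetoid_le {x y : Fin d} {r : Setoid (Fin d)} : pairSetoid x y ≤ r ↔ r x y := by
  constructor
  · intro h
    exact h (show (pairSetoid x y) x y from Or.inr (Or.inl ⟨rfl, rfl⟩))
  · rintro h u v (rfl | ⟨rfl, rfl⟩ | ⟨rfl, rfl⟩)
    · exact r.refl _
    · exact h
    · exact r.symm h

/-- The setoid `r` with `x` made a singleton class. -/
def isolate (r : Setoid (Fin d)) (x : Fin d) : Setoid (Fin d) where
  r u v := u = v ∨ (u ≠ x ∧ v ≠ x ∧ r u v)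
  iseqv := ⟨fun _ => Or.inl rfl, by
    rintro u v (rfl | ⟨h1, h2, h⟩)
    · exact Or.inl rfl
    · exact Or.inr ⟨h2, h1, r.symm h⟩, by
    rintro u v t (rfl | ⟨h1, h2, h⟩) (rfl | ⟨h3, h4, h'⟩)
    · exact Or.inl rfl
    · exact Or.inr ⟨h3, h4, h'⟩
    · exact Or.inr ⟨h1, h2, h⟩
    · exact Or.inr ⟨h1, h4, r.trans h h'⟩⟩

lemma isolate_rel {r : Setoid (Fin d)} {x u v : Fin d} :
    isolate r x u v ↔ u = v ∨ (u ≠ x ∧ v ≠ x ∧ r u v) := Iff.rfl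

lemma isolate_le (r : Setoid (Fin d)) (x : Fin d) : isolate r x ≤ r := by
  rintro u v (rfl | ⟨_, _, h⟩)
  · exact r.refl _
  · exact h

lemma sup_pairSetoid_eq_iff {r s : Setoid (Fin d)} {x j : Fin d} (hj : j ≠ x) (hr : r x j)
    (hs : s ≤ isolate r x) : s ⊔ pairSetoid x j = r ↔ s = isolate r x := by
  constructor
  · intro h
    refine le_antisymm hs ?_
    let f : Fin d → Fin d := fun u => if u = x then j else u
    have hη : r ≤ s.comap f := by
      rw [← h]
      refine sup_le ?_ (pairSetoid_le.2 ?_)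
      · intro u v huv
        rcases hs huv with rfl | ⟨hu, hv, _⟩
        · exact s.refl _
        · simpa [Setoid.comap_rel, f, hu, hv] using huv
      · simp only [Setoid.comap_rel, f, if_true, if_neg hj]
        exact s.refl _
    rintro y z (rfl | ⟨hy, hz, hyz⟩)
    · exact s.refl _
    · simpa [Setoid.comap_rel, f, hy, hz] using hη hyz
  · rintro rfl
    refine le_antisymm (sup_le (isolate_le r x) (pairSetoid_le.2 hr)) ?_
    intro y z hyz
    set t := isolate r x ⊔ pairSetoid x j
    have h1 : ∀ {u v}, u ≠ x → v ≠ x → r u v → t u v := fun hu hv h =>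
      (le_sup_left : isolate r x ≤ t) (isolate_rel.2 (Or.inr ⟨hu, hv, h⟩))
    have h2 : t x j := pairSetoid_le.1 (le_sup_right : pairSetoid x j ≤ t)
    by_cases hy : y = x <;> by_cases hz : z = x
    · rw [hy, hz]
    · subst hy
      exact t.trans h2 (h1 hj hz (r.trans (r.symm hr) hyz))
    · subst hz
      exact t.symm (t.trans h2 (h1 hj hy (r.trans (r.symm hr) (r.symm hyz))))
    · exact h1 hy hz hyz

lemma eRel_apply_eq (r : Setoid (Fin d)) (w : NCWord d) :
    eRel r w = if ∀ j k, j ≠ k → r j k → w j ≠ w k then 1 else 0 := by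
  refine if_congr ?_ rfl rfl
  rw [eq_bot_iff]
  constructor
  · intro h j k hjk hr hw
    exact hjk (h (show (r ⊓ Setoid.ker w) j k from ⟨hr, hw⟩))
  · rintro h j k ⟨hr, hw⟩
    by_contra hjk
    exact h j k hjk hr hw

lemma eRel_eq_isolate (r : Setoid (Fin d)) (x : Fin d) (w : NCWord d) :
    eRel r w = eRel (isolate r x) w *
      (1 - ∑ j with j ≠ x ∧ r x j, if w x = w j then (1 : ℚ) else 0) := by
  simp only [eRel_apply_eq, isolate_rel]
  by_cases h : ∀ j k, j ≠ k → j = k ∨ (j ≠ x ∧ k ≠ x ∧ r j k) → w j ≠ w k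
  · rw [if_pos h, one_mul]
    by_cases hx : ∃ j, j ≠ x ∧ r x j ∧ w x = w j
    · obtain ⟨j, hj, hr, hw⟩ := hx
      rw [if_neg fun h' => h' x j hj.symm hr hw, Finset.sum_eq_single j]
      · simp [hw]
      · intro k hk hkj
        simp only [mem_filter, mem_univ, true_and] at hk
        rw [if_neg]
        intro hwk
        exact h k j hkj (Or.inr ⟨hk.1, hj, r.trans (r.symm hk.2) hr⟩) (hwk.symm.trans hw)
      · intro h'
        simp [hj, hr] at h'
    · push Not at hx
      rw [if_pos, Finset.sum_eq_zero, sub_zero]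
      · intro j hj
        simp only [mem_filter, mem_univ, true_and] at hj
        rw [if_neg (hx j hj.1 hj.2)]
      · intro j k hjk hr
        by_cases hj : j = x
        · subst hj
          exact hx k hjk.symm hr
        · by_cases hk : k = x
          · subst hk
            exact (hx j hj (r.symm hr)).symm
          · exact h j k hjk (Or.inr ⟨hj, hk, hr⟩)
  · rw [if_neg h, zero_mul, if_neg]
    intro h'
    apply h
    rintro j k hjk (h1 | ⟨_, _, hr⟩)
    · exact absurd h1 hjk
    · exact h' j k hjk hr

lemma pRel_mul_pair (s : Setoid (Fin d)) (x j : Fin d) (w : NCWord d) :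
    pRel s w * (if w x = w j then (1 : ℚ) else 0) = pRel (s ⊔ pairSetoid x j) w := by
  simp only [pRel, sup_le_iff, pairSetoid_le, Setoid.ker_def]
  split_ifs <;> simp_all

lemma mobBot_isolate {r : Setoid (Fin d)} {x y : Fin d} (hy : y ≠ x) (hr : r x y) :
    mobBot r = - ((univ.filter fun j => j ≠ x ∧ r x j).card : ℚ) * mobBot (isolate r x) := by
  have key : eRel r = ∑ s ∈ Icc ⊥ (isolate r x),
      mobBot s • (pRel s - ∑ j with j ≠ x ∧ r x j, pRel (s ⊔ pairSetoid x j)) := by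
    ext w
    rw [eRel_eq_isolate r x w, eRel_eq_sum (isolate r x)]
    simp only [Finset.sum_apply, Pi.smul_apply, Pi.sub_apply, smul_eq_mul, Finset.sum_mul]
    refine Finset.sum_congr rfl fun s _ => ?_
    simp only [← pRel_mul_pair, ← Finset.mul_sum]
    ring
  have h := congrArg (pCoeff r) key
  rw [pCoeff_eRel, if_pos le_rfl, map_sum] at h
  rw [h, Finset.sum_eq_single (isolate r x)]
  · have hne : isolate r x ≠ r := by
      intro h
      rw [← h] at hr
      rcases hr with h | h
      · exact hy h.symm
      · exact h.1 rfl
    rw [map_smul, map_sub, map_sum, pCoeff_pRel, if_neg hne, Finset.sum_congr rfl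
      (g := fun _ => (1 : ℚ))]
    · simp; ring
    · intro j hj
      simp only [mem_filter, mem_univ, true_and] at hj
      rw [pCoeff_pRel, if_pos ((sup_pairSetoid_eq_iff hj.1 hj.2 le_rfl).2 rfl)]
  · intro s hs hne
    have hs' := (Finset.mem_Icc.1 hs).2
    have hsr : s ≠ r := by
      rintro rfl
      exact hne (le_antisymm hs' (isolate_le _ _))
    rw [map_smul, map_sub, map_sum, pCoeff_pRel, if_neg hsr, Finset.sum_eq_zero]
    · simp
    · intro j hj
      simp only [mem_filter, mem_univ, true_and] at hj
      rw [pCoeff_pRel, if_neg]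
      rwa [sup_pairSetoid_eq_iff hj.1 hj.2 hs']
  · simp

lemma mobBot_ne_zero (r : Setoid (Fin d)) : mobBot r ≠ 0 := by
  induction r using WellFoundedLT.induction with
  | ind r ih =>
    by_cases h : r = ⊥
    · simp [mobBot, h]
    · obtain ⟨x, y, hy, hr⟩ : ∃ x y, y ≠ x ∧ r x y := by
        by_contra! h'
        refine h (eq_bot_iff.2 fun x y hxy => ?_)
        by_contra hne
        exact h' x y (Ne.symm hne) hxy
      rw [mobBot_isolate hy hr]
      refine mul_ne_zero (neg_ne_zero.2 (Nat.cast_ne_zero.2 ?_)) (ih _ ?_)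
      · exact Finset.card_ne_zero_of_mem (a := y) (by simp [hy, hr])
      · refine lt_of_le_of_ne (isolate_le r x) ?_
        intro h
        rw [← h] at hr
        rcases hr with h | h
        · exact hy h.symm
        · exact h.1 rfl

lemma pRel_mem_span (r : Setoid (Fin d)) :
    pRel r ∈ Submodule.span ℚ (Set.range (eRel : Setoid (Fin d) → Md d)) := by
  induction r using WellFoundedLT.induction with
  | ind r ih =>
    have h := eRel_eq_sum r
    rw [← Finset.Ico_insert_right bot_le, Finset.sum_insert (by simp)] at h
    have h2 : pRel r = (mobBot r)⁻¹ • (eRel r - ∑ s ∈ Ico ⊥ r, mobBot s • pRel s) := by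
      rw [h, add_sub_cancel_right, smul_smul, inv_mul_cancel₀ (mobBot_ne_zero r), one_smul]
    rw [h2]
    refine Submodule.smul_mem _ _ (Submodule.sub_mem _ (Submodule.subset_span ⟨r, rfl⟩) ?_)
    exact Submodule.sum_mem _ fun s hs => Submodule.smul_mem _ _ (ih s (Finset.mem_Ico.1 hs).2)

/-- The equivalence relation whose classes are the blocks of `π`. -/
def blockRel (π : SetPtn d) : Setoid (Fin d) where
  r := sameBlock π
  iseqv := ⟨fun x => by
      obtain ⟨B, hB, hx⟩ := π.exists_mem (Finset.mem_univ x)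
      exact ⟨B, hB, hx, hx⟩,
    fun ⟨B, hB, hx, hy⟩ => ⟨B, hB, hy, hx⟩, by
      rintro x y z ⟨B, hB, hx, hy⟩ ⟨C, hC, hy', hz⟩
      obtain rfl := π.eq_of_mem_parts hB hC hy hy'
      exact ⟨B, hB, hx, hz⟩⟩

lemma eSP_eq_eRel (π : SetPtn d) : eSP π = eRel (blockRel π) := by
  ext w
  rw [eRel_apply_eq]
  rfl

lemma exists_blockRel_eq (r : Setoid (Fin d)) : ∃ π : SetPtn d, blockRel π = r := by
  refine ⟨Finpartition.ofSetoid r, ?_⟩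
  ext x y
  rw [← Finpartition.mem_part_ofSetoid_iff_rel (s := r), Finpartition.mem_part_iff_exists]
  exact exists_congr fun B => and_congr_right fun _ => and_comm

lemma mem_blockOf {π : SetPtn d} {x y : Fin d} : y ∈ blockOf π x ↔ blockRel π x y := by
  simp only [blockOf, mem_filter, mem_univ, true_and]
  rfl

lemma blockOf_eq_part (π : SetPtn d) (x : Fin d) : blockOf π x = π.part x := by
  ext y
  rw [Finpartition.mem_part_iff_exists, mem_blockOf]
  exact exists_congr fun B => and_congr_right fun _ => and_comm

/-- The size of the class of `x`. -/
def classCard (r : Setoid (Fin d)) (x : Fin d) : ℕ := #{y | r x y}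

/-- The number of elements outside of the class of `a` that lie in a class of size `k`. -/
def outerCount (r : Setoid (Fin d)) (a : Fin d) (k : ℕ) : ℕ := #{x | ¬ r a x ∧ classCard r x = k}

lemma outerCount_blockRel (π : SetPtn d) (a : Fin d) (k : ℕ) :
    outerCount (blockRel π) a k = (ptype π a).1.count k * k := by
  have h1 : (univ.filter fun x => ¬ blockRel π a x ∧ classCard (blockRel π) x = k) =
      ((π.parts.erase (blockOf π a)).filter fun B => k = #B).biUnion id := by
    ext x
    simp only [mem_filter, mem_univ, true_and, mem_biUnion, mem_erase, id]
    constructor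
    · rintro ⟨hx, hk⟩
      refine ⟨blockOf π x, ⟨⟨?_, ?_⟩, hk.symm⟩, ?_⟩
      · intro h
        apply hx
        have : x ∈ blockOf π a := by
          rw [← h, blockOf_eq_part]
          simp
        exact mem_blockOf.1 this
      · rw [blockOf_eq_part]
        simp
      · rw [blockOf_eq_part]
        simp
    · rintro ⟨B, ⟨⟨hne, hB⟩, hk⟩, hx⟩
      have hBx : blockOf π x = B := by
        rw [blockOf_eq_part]
        exact π.part_eq_of_mem hB hx
      refine ⟨?_, ?_⟩
      · rintro ⟨C, hC, ha, hx'⟩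
        obtain rfl := π.eq_of_mem_parts hB hC hx hx'
        apply hne
        rw [blockOf_eq_part, π.part_eq_of_mem hB ha]
      · rw [hk, ← hBx]
        rfl
  rw [outerCount, h1, Finset.card_biUnion, Finset.sum_congr rfl (g := fun _ => k)]
  · rw [Finset.sum_const, smul_eq_mul, ptype, Multiset.count_map]
    rfl
  · intro B hB
    exact (mem_filter.1 hB).2.symm
  · intro B hB C hC hne
    simp only [coe_filter, Set.mem_ofPred_eq, mem_erase] at hB hC
    exact π.disjoint hB.1.2 hC.1.2 hne

lemma ptype_eq_iff (π π' : SetPtn d) (a : Fin d) :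
    ptype π a = ptype π' a ↔ classCard (blockRel π) a = classCard (blockRel π') a ∧
      ∀ k, outerCount (blockRel π) a k = outerCount (blockRel π') a k := by
  constructor
  · intro h
    refine ⟨congrArg Prod.snd h, fun k => ?_⟩
    rw [outerCount_blockRel, outerCount_blockRel, h]
  · rintro ⟨h1, h2⟩
    refine Prod.ext ?_ h1
    ext k
    have := h2 k
    rw [outerCount_blockRel, outerCount_blockRel] at this
    rcases Nat.eq_zero_or_pos k with rfl | hk
    · have h0 : ∀ ρ : SetPtn d, (ptype ρ a).1.count 0 = 0 := by
        intro ρ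
        refine Multiset.count_eq_zero.2 fun h => ?_
        obtain ⟨B, hB, h0⟩ := Multiset.mem_map.1 h
        exact ρ.ne_empty (Finset.mem_of_mem_erase hB) (Finset.card_eq_zero.1 h0)
      rw [h0, h0]
    · exact Nat.eq_of_mul_eq_mul_right hk this

/-- The setoids `r` and `s` have the same type relative to `a`. -/
def SameType (a : Fin d) (r s : Setoid (Fin d)) : Prop :=
  classCard r a = classCard s a ∧ ∀ k, outerCount r a k = outerCount s a k

lemma eRel_sub_mem_Ksub {a : Fin d} {r s : Setoid (Fin d)} (h : SameType a r s) :
    eRel r - eRel s ∈ Ksub a := by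
  obtain ⟨π, rfl⟩ := exists_blockRel_eq r
  obtain ⟨π', rfl⟩ := exists_blockRel_eq s
  exact Submodule.subset_span
    ⟨π, π', (ptype_eq_iff π π' a).2 h, by rw [eSP_eq_eRel, eSP_eq_eRel]⟩

lemma Ksub_eq_span (a : Fin d) :
    Ksub a = Submodule.span ℚ {f | ∃ r s, SameType a r s ∧ f = eRel r - eRel s} := by
  refine le_antisymm (Submodule.span_le.2 ?_) (Submodule.span_le.2 ?_)
  · rintro f ⟨π, π', h, rfl⟩
    exact Submodule.subset_span ⟨blockRel π, blockRel π', (ptype_eq_iff π π' a).1 h, by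
      rw [eSP_eq_eRel, eSP_eq_eRel]⟩
  · rintro f ⟨r, s, h, rfl⟩
    exact eRel_sub_mem_Ksub h

lemma isEPosNCAt_iff {G : SimpleGraph (Fin d)} {a : Fin d} : IsEPosNCAt G a ↔
    ∃ c : Setoid (Fin d) → ℚ, (∀ r, 0 ≤ c r) ∧ YG G - ∑ r, c r • eRel r ∈ Ksub a := by
  constructor
  · rintro ⟨s, c, hc, h⟩
    refine ⟨fun r => ∑ π ∈ s with blockRel π = r, c π, fun r => sum_nonneg fun π _ => hc π, ?_⟩
    convert! h using 2
    rw [← Finset.sum_fiberwise s blockRel]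
    refine Finset.sum_congr rfl fun r _ => ?_
    rw [Finset.sum_smul]
    refine Finset.sum_congr rfl fun π hπ => ?_
    rw [eSP_eq_eRel, (mem_filter.1 hπ).2]
  · rintro ⟨c, hc, h⟩
    choose f hf using exists_blockRel_eq (d := d)
    refine ⟨univ.image f, fun π => c (blockRel π), fun π => hc _, ?_⟩
    rw [Finset.sum_image (Function.LeftInverse.injective hf).injOn]
    simpa only [eSP_eq_eRel, hf] using h

lemma reachableSetoid_le_iff {G : SimpleGraph (Fin d)} {r : Setoid (Fin d)} :
    G.reachableSetoid ≤ r ↔ ∀ x y, G.Adj x y → r x y := by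
  constructor
  · intro h x y hxy
    exact h (show G.Reachable x y from hxy.reachable)
  · rintro h x y ⟨p⟩
    induction p with
    | nil => exact r.refl _
    | cons hadj _ ih => exact r.trans (h _ _ hadj) ih

lemma YG_eq_sum (G : SimpleGraph (Fin d)) :
    YG G = ∑ S ∈ G.edgeFinset.powerset, (-1 : ℚ) ^ #S •
      pRel (SimpleGraph.fromEdgeSet (S : Set (Sym2 (Fin d)))).reachableSetoid := by
  ext w
  have h1 : YG G w = ∏ e ∈ G.edgeFinset, (1 + -(if (e.map w).IsDiag then (1 : ℚ) else 0)) := by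
    have : ∀ e : Sym2 (Fin d), (1 + -(if (e.map w).IsDiag then (1 : ℚ) else 0)) =
        if ¬ (e.map w).IsDiag then 1 else 0 := by
      intro e
      split_ifs <;> simp_all
    simp only [this]
    rw [Finset.prod_boole, YG]
    congr 1
    rw [eq_iff_iff]
    constructor
    · intro h e
      induction e with
      | _ x y => simpa using h x y
    · intro h x y hxy
      simpa using h s(x, y) (by simpa using hxy)
  rw [h1, Finset.prod_one_add, Finset.sum_apply]
  refine Finset.sum_congr rfl fun S hS => ?_
  rw [Finset.prod_neg, Finset.prod_boole]
  simp only [Pi.smul_apply, smul_eq_mul, pRel]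
  congr 1
  congr 1
  rw [eq_iff_iff, reachableSetoid_le_iff]
  constructor
  · intro h x y hxy
    simpa using h s(x, y) ((SimpleGraph.fromEdgeSet_adj _).1 hxy).1
  · intro h e he
    induction e with
    | _ x y =>
      have : G.Adj x y := by simpa using mem_powerset.1 hS he
      simpa using h x y ((SimpleGraph.fromEdgeSet_adj _).2 ⟨he, this.ne⟩)

lemma YG_mem_span (G : SimpleGraph (Fin d)) :
    YG G ∈ Submodule.span ℚ (Set.range (eRel : Setoid (Fin d) → Md d)) := by
  rw [YG_eq_sum]
  exact Submodule.sum_mem _ fun S _ => Submodule.smul_mem _ _ (pRel_mem_span _)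

/-- The setoid with classes `B` and its complement. -/
def sideSetoid (B : Finset (Fin d)) : Setoid (Fin d) := Setoid.ker (· ∈ B)

lemma sideSetoid_rel {B : Finset (Fin d)} {x y : Fin d} :
    sideSetoid B x y ↔ (x ∈ B ↔ y ∈ B) := by
  rw [sideSetoid, Setoid.ker_def, eq_iff_iff]

lemma sideSetoid_le_iff {B : Finset (Fin d)} {r : Setoid (Fin d)} (hr : r ≠ ⊤) :
    sideSetoid B ≤ r ↔ r = sideSetoid B := by
  refine ⟨fun h => ?_, fun h => h.ge⟩
  refine le_antisymm ?_ h
  intro x y hxy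
  by_contra hne
  apply hr
  have hside : ∀ {u v}, (u ∈ B ↔ v ∈ B) → r u v := fun huv => h (sideSetoid_rel.2 huv)
  rw [sideSetoid_rel] at hne
  have hx : ∀ u, r x u := by
    intro u
    by_cases hu : x ∈ B ↔ u ∈ B
    · exact hside hu
    · exact r.trans hxy (hside (by tauto))
  exact eq_top_iff.2 fun u v _ => r.trans (r.symm (hx u)) (hx v)

lemma eq_top_iff_classCard (r : Setoid (Fin d)) (a : Fin d) : r = ⊤ ↔ classCard r a = d := by
  constructor
  · rintro rfl
    simp [classCard]
  · intro h
    have h' : (univ.filter fun y => r a y) = univ := by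
      apply Finset.eq_univ_of_card
      rw [Fintype.card_fin]
      exact h
    have hx : ∀ u, r a u := by simpa [Finset.filter_eq_self] using h'
    exact eq_top_iff.2 fun u v _ => r.trans (r.symm (hx u)) (hx v)

/-- The `m`-element sets containing `a`. -/
def sides (a : Fin d) (m : ℕ) : Finset (Finset (Fin d)) := {B | a ∈ B ∧ #B = m}

lemma mem_sides {a : Fin d} {m : ℕ} {B : Finset (Fin d)} : B ∈ sides a m ↔ a ∈ B ∧ #B = m := by
  simp [sides]

lemma card_sides_le_eq {a : Fin d} {m : ℕ} (hm : m < d) {r : Setoid (Fin d)}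
    (hr : r ≠ ⊤) :
    #{B ∈ sides a m | sideSetoid B ≤ r} =
      if classCard r a = m ∧ outerCount r a (d - m) = d - m then 1 else 0 := by
  simp only [sideSetoid_le_iff hr]
  split_ifs with h
  · obtain ⟨h1, h2⟩ := h
    set A : Finset (Fin d) := univ.filter fun y => r a y with hA
    have hAm : #A = m := h1
    have memA : ∀ x, x ∈ A ↔ r a x := by simp [hA]
    obtain ⟨x, hx⟩ : (univ.filter fun x => ¬ r a x ∧ classCard r x = d - m).Nonempty := by
      rw [← Finset.card_pos]
      change 0 < outerCount r a (d - m)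
      omega
    simp only [mem_filter, mem_univ, true_and] at hx
    have hC : (univ.filter fun y => r x y) = Aᶜ := by
      apply Finset.eq_of_subset_of_card_le
      · intro y hy
        simp only [mem_filter, mem_univ, true_and] at hy
        rw [mem_compl, memA]
        exact fun h => hx.1 (r.trans h (r.symm hy))
      · rw [Finset.card_compl, hAm, Fintype.card_fin]
        exact hx.2.ge
    have memC : ∀ y, r x y ↔ ¬ r a y := by
      intro y
      rw [← memA, ← mem_compl, ← hC]
      simp
    have hrA : r = sideSetoid A := by
      ext u v
      rw [sideSetoid_rel, memA, memA]
      constructor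
      · intro h
        exact ⟨fun h' => r.trans h' h, fun h' => r.trans h' (r.symm h)⟩
      · intro h
        by_cases hu : r a u
        · exact r.trans (r.symm hu) (h.1 hu)
        · exact r.trans (r.symm ((memC u).2 hu)) ((memC v).2 (by tauto))
    rw [Finset.card_eq_one]
    refine ⟨A, ?_⟩
    ext B
    rw [mem_filter, mem_singleton, mem_sides]
    constructor
    · rintro ⟨⟨haB, _⟩, hB⟩
      ext y
      rw [memA, hB, sideSetoid_rel]
      simp [haB]
    · rintro rfl
      exact ⟨⟨(memA a).2 (r.refl a), hAm⟩, hrA⟩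
  · rw [Finset.card_eq_zero, Finset.filter_eq_empty_iff]
    rintro B hB rfl
    rw [mem_sides] at hB
    apply h
    have hB' : (univ.filter fun y => sideSetoid B a y) = B := by
      ext y
      simp [sideSetoid_rel, hB.1]
    have hc : ∀ x ∉ B, classCard (sideSetoid B) x = d - m := by
      intro x hx
      have : (univ.filter fun y => sideSetoid B x y) = Bᶜ := by
        ext y
        simp [sideSetoid_rel, hx]
      rw [classCard, this, Finset.card_compl, hB.2, Fintype.card_fin]
    refine ⟨by rw [classCard, hB', hB.2], ?_⟩
    have : (univ.filter fun x => ¬ sideSetoid B a x ∧ classCard (sideSetoid B) x = d - m) = Bᶜ := by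
      ext y
      simp only [mem_filter, mem_univ, true_and, sideSetoid_rel, hB.1, true_iff, mem_compl]
      exact ⟨fun h => h.1, fun h => ⟨h, hc y h⟩⟩
    rw [outerCount, this, Finset.card_compl, hB.2, Fintype.card_fin]

lemma pCoeff_YG_ne_zero {G : SimpleGraph (Fin d)} {r : Setoid (Fin d)}
    (h : pCoeff r (YG G) ≠ 0) : ∃ H ≤ G, H.reachableSetoid = r := by
  by_contra! h'
  apply h
  rw [YG_eq_sum, map_sum]
  refine Finset.sum_eq_zero fun S hS => ?_
  rw [map_smul, pCoeff_pRel, if_neg, smul_zero]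
  apply h'
  intro x y hxy
  have := mem_powerset.1 hS ((SimpleGraph.fromEdgeSet_adj _).1 hxy).1
  simpa using this

lemma pCoeff_top_YG {G : SimpleGraph (Fin d)} (hG : G.IsTree) :
    pCoeff ⊤ (YG G) = (-1) ^ #G.edgeFinset := by
  rw [YG_eq_sum, map_sum, Finset.sum_eq_single G.edgeFinset]
  · rw [map_smul, pCoeff_pRel, if_pos, smul_eq_mul, mul_one]
    rw [SimpleGraph.coe_edgeFinset, SimpleGraph.fromEdgeSet_edgeSet, eq_top_iff]
    intro x y _
    exact hG.connected.preconnected x y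
  · intro S hS hne
    rw [map_smul, pCoeff_pRel, if_neg, smul_zero]
    intro htop
    obtain ⟨e, he, heS⟩ := Finset.exists_of_ssubset
      (Finset.ssubset_iff_subset_ne.2 ⟨mem_powerset.1 hS, hne⟩)
    induction e with
    | _ x y =>
      have hb := SimpleGraph.isAcyclic_iff_forall_adj_isBridge.1 hG.isAcyclic
        (show G.Adj x y by simpa using he)
      rw [SimpleGraph.isBridge_iff] at hb
      have hxy : (SimpleGraph.fromEdgeSet (S : Set (Sym2 (Fin d)))).Reachable x y := by
        change (SimpleGraph.fromEdgeSet (S : Set (Sym2 (Fin d)))).reachableSetoid x y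
        rw [htop]
        trivial
      refine hb (hxy.mono ?_)
      intro u v huv
      have h1 := ((SimpleGraph.fromEdgeSet_adj _).1 huv).1
      have h2 : s(u, v) ∈ G.edgeFinset := mem_powerset.1 hS h1
      simp only [SimpleGraph.deleteEdges_adj, Set.mem_singleton_iff]
      refine ⟨by simpa using h2, ?_⟩
      intro h
      rw [h] at h1
      exact heS h1
  · simp

lemma apply_YG_nonneg {G : SimpleGraph (Fin d)} {a : Fin d} (h : IsEPosNCAt G a)
    (Φ : Md d →ₗ[ℚ] ℚ) (hΦ : ∀ r s, SameType a r s → Φ (eRel r) = Φ (eRel s))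
    (hpos : ∀ r, 0 ≤ Φ (eRel r)) : 0 ≤ Φ (YG G) := by
  obtain ⟨c, hc, h⟩ := isEPosNCAt_iff.1 h
  have hK : Ksub a ≤ LinearMap.ker Φ := by
    rw [Ksub_eq_span]
    refine Submodule.span_le.2 ?_
    rintro f ⟨r, s, hrs, rfl⟩
    simp [hΦ r s hrs]
  have h0 := hK h
  rw [LinearMap.mem_ker, map_sub, sub_eq_zero] at h0
  rw [h0, map_sum]
  refine Finset.sum_nonneg fun r _ => ?_
  rw [map_smul]
  exact mul_nonneg (hc r) (hpos r)

lemma exists_side {G : SimpleGraph (Fin d)} (hG : G.IsTree) {a : Fin d} (h : IsEPosNCAt G a)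
    {m : ℕ} (hm0 : 0 < m) (hm : m < d) :
    ∃ B, a ∈ B ∧ #B = m ∧ ∃ H ≤ G, H.reachableSetoid = sideSetoid B := by
  by_contra! hno
  have hY : ∀ B ∈ sides a m, pCoeff (sideSetoid B) (YG G) = 0 := by
    intro B hB
    by_contra h0
    obtain ⟨H, hH, hr⟩ := pCoeff_YG_ne_zero h0
    exact hno B (mem_sides.1 hB).1 (mem_sides.1 hB).2 H hH hr
  set κ : ℚ := mobBot (⊤ : Setoid (Fin d)) with hκ
  have hκ0 : 0 < |κ| := abs_pos.2 (mobBot_ne_zero _)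
  set y : ℚ := (-1) ^ #G.edgeFinset with hy
  have hyy : |y| = 1 := by simp [hy]
  set N : ℚ := (#(sides a m) : ℚ) with hN
  have hN0 : 0 < N := by
    obtain ⟨B, h1, h2, h3⟩ := Finset.exists_subsuperset_card_eq (s := {a}) (t := univ) (n := m)
      (by simp) (by rw [card_singleton]; exact hm0) (by simpa using hm.le)
    exact Nat.cast_pos.2 (Finset.card_pos.2 ⟨B, mem_sides.2 ⟨by simpa using h1, h3⟩⟩)
  let Φ : Md d →ₗ[ℚ] ℚ :=
    |κ| • ∑ B ∈ sides a m, (mobBot (sideSetoid B))⁻¹ • pCoeff (sideSetoid B) - (N * y) • pCoeff ⊤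
  have hΦ : ∀ f, Φ f = |κ| * ∑ B ∈ sides a m, (mobBot (sideSetoid B))⁻¹ * pCoeff (sideSetoid B) f
      - (N * y) * pCoeff ⊤ f := by
    intro f
    simp [Φ, LinearMap.sum_apply]
  have hE : ∀ r, Φ (eRel r) = |κ| * (#{B ∈ sides a m | sideSetoid B ≤ r} : ℚ)
      - (N * y) * if r = ⊤ then κ else 0 := by
    intro r
    rw [hΦ, pCoeff_eRel]
    simp only [pCoeff_eRel, top_le_iff, mul_ite, mul_zero,
      inv_mul_cancel₀ (mobBot_ne_zero _), ← Finset.sum_filter]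
    simp [hκ]
  have h0 := apply_YG_nonneg h Φ ?_ ?_
  · rw [hΦ, pCoeff_top_YG hG, Finset.sum_eq_zero fun B hB => by rw [hY B hB, mul_zero]] at h0
    have : y * y = 1 := by rw [← abs_mul_abs_self, hyy, one_mul]
    nlinarith
  · rintro r s ⟨h1, h2⟩
    rw [hE, hE]
    by_cases hr : r = ⊤
    · have hs : s = ⊤ := by
        rwa [eq_top_iff_classCard s a, ← h1, ← eq_top_iff_classCard]
      rw [hr, hs]
    · have hs : s ≠ ⊤ := by
        rwa [Ne, eq_top_iff_classCard s a, ← h1, ← eq_top_iff_classCard]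
      rw [if_neg hr, if_neg hs, card_sides_le_eq hm hr, card_sides_le_eq hm hs, h1, h2]
  · intro r
    rw [hE]
    split_ifs with hr
    · subst hr
      have h1 : y * κ ≤ |κ| := by
        calc y * κ ≤ |y * κ| := le_abs_self _
          _ = |κ| := by rw [abs_mul, hyy, one_mul]
      simp only [le_top, Finset.filter_true]
      nlinarith
    · rw [mul_zero, sub_zero]
      positivity

lemma leaving_edge_unique {G H : SimpleGraph (Fin d)} (hG : G.IsTree) (hHG : H ≤ G)
    {B : Finset (Fin d)} (hH : H.reachableSetoid = sideSetoid B) {x x' y y' : Fin d}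
    (hx : x ∈ B) (hx' : x' ∈ B) (hy : y ∉ B) (hy' : y' ∉ B) (h : G.Adj x y) (h' : G.Adj x' y') :
    y = y' := by
  by_contra hne
  have hreach : ∀ u v, H.Reachable u v ↔ (u ∈ B ↔ v ∈ B) := by
    intro u v
    rw [← sideSetoid_rel, ← hH]
    rfl
  have hle : H ≤ G.deleteEdges {s(x, y)} := by
    intro u v huv
    have huv' := (hreach u v).1 huv.reachable
    simp only [SimpleGraph.deleteEdges_adj, Set.mem_singleton_iff]
    refine ⟨hHG huv, ?_⟩
    rw [Sym2.eq_iff]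
    rintro (⟨rfl, rfl⟩ | ⟨rfl, rfl⟩) <;> tauto
  have hb := SimpleGraph.isAcyclic_iff_forall_adj_isBridge.1 hG.isAcyclic h
  rw [SimpleGraph.isBridge_iff] at hb
  apply hb
  have h1 : (G.deleteEdges {s(x, y)}).Adj x' y' := by
    simp only [SimpleGraph.deleteEdges_adj, Set.mem_singleton_iff]
    refine ⟨h', ?_⟩
    rw [Sym2.eq_iff]
    rintro (⟨_, rfl⟩ | ⟨rfl, rfl⟩) <;> tauto
  exact (((hreach x x').2 (by tauto)).mono hle).trans
    (h1.reachable.trans (((hreach y' y).2 (by tauto)).mono hle))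

lemma dist_lt_card {G H : SimpleGraph (Fin d)} (hHG : H ≤ G)
    {B : Finset (Fin d)} (hH : H.reachableSetoid = sideSetoid B) {a x : Fin d}
    (ha : a ∈ B) (hx : x ∈ B) : G.dist a x < #B := by
  have hreach : ∀ u v, H.Reachable u v ↔ (u ∈ B ↔ v ∈ B) := by
    intro u v
    rw [← sideSetoid_rel, ← hH]
    rfl
  obtain ⟨p, hp⟩ := ((hreach a x).2 (by tauto)).exists_isPath
  have hsub : p.support.toFinset ⊆ B := by
    intro u hu
    have := (hreach a u).1 (p.takeUntil u (List.mem_toFinset.1 hu)).reachable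
    tauto
  have hc := Finset.card_le_card hsub
  rw [List.toFinset_card_of_nodup hp.support_nodup, SimpleGraph.Walk.length_support] at hc
  have hd := SimpleGraph.dist_le (p.mapLe hHG)
  rw [SimpleGraph.Walk.length_mapLe] at hd
  omega

lemma exists_adj_dist {G : SimpleGraph (Fin d)} (hG : G.Connected) {a x : Fin d} {k : ℕ}
    (hk : G.dist a x = k + 1) : ∃ z, G.Adj z x ∧ G.dist a z = k := by
  obtain ⟨p, hp⟩ := (hG.preconnected x a).exists_walk_length_eq_dist
  rw [SimpleGraph.dist_comm, hk] at hp
  cases p with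
  | nil => simp at hp
  | @cons _ z _ h p =>
    rw [SimpleGraph.Walk.length_cons] at hp
    refine ⟨z, h.symm, le_antisymm ?_ ?_⟩
    · have := SimpleGraph.dist_le p
      rw [SimpleGraph.dist_comm]
      omega
    · have h1 := hG.dist_triangle (u := a) (v := z) (w := x)
      have h2 := SimpleGraph.dist_eq_one_iff_adj.2 h.symm
      omega

lemma dist_injective {G : SimpleGraph (Fin d)} (hG : G.IsTree) {a : Fin d}
    (h : ∀ m, 0 < m → m < d → ∃ B, a ∈ B ∧ #B = m ∧ ∃ H ≤ G, H.reachableSetoid = sideSetoid B) :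
    Function.Injective (G.dist a) := by
  have hball : ∀ m, 0 < m → m < d → #{x | G.dist a x < m} = m ∧
      ∃ H ≤ G, H.reachableSetoid = sideSetoid {x | G.dist a x < m} := by
    intro m hm0
    induction m, hm0 using Nat.le_induction with
    | base =>
      intro hd
      obtain ⟨B, haB, hB, H, hHG, hH⟩ := h 1 one_pos hd
      obtain ⟨b, rfl⟩ := Finset.card_eq_one.1 hB
      rw [mem_singleton] at haB
      subst haB
      have : (univ.filter fun x => G.dist a x < 1) = {a} := by
        ext x
        simp [hG.connected.dist_eq_zero_iff, eq_comm]
      rw [this]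
      exact ⟨hB, H, hHG, hH⟩
    | succ m hm0 ih =>
      intro hd
      obtain ⟨hc, H', hHG', hH'⟩ := ih (by omega)
      obtain ⟨B, haB, hB, H, hHG, hH⟩ := h (m + 1) (by omega) hd
      suffices hEq : B = univ.filter fun x => G.dist a x < m + 1 by
        rw [← hEq]
        exact ⟨hB, H, hHG, hH⟩
      refine Finset.eq_of_subset_of_card_le (fun x hx => ?_) ?_
      · simpa [hB] using dist_lt_card hHG hH haB hx
      · have hone : #{x | G.dist a x = m} ≤ 1 := by
          rw [Finset.card_le_one]
          intro x hx y hy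
          simp only [mem_filter, mem_univ, true_and] at hx hy
          obtain ⟨k, rfl⟩ : ∃ k, m = k + 1 := ⟨m - 1, by omega⟩
          obtain ⟨u, hu, hu'⟩ := exists_adj_dist hG.connected hx
          obtain ⟨v, hv, hv'⟩ := exists_adj_dist hG.connected hy
          exact leaving_edge_unique hG hHG' hH' (by simp [hu']) (by simp [hv']) (by simp [hx])
            (by simp [hy]) hu hv
        have hsub : (univ.filter fun x => G.dist a x < m + 1) ⊆
            (univ.filter fun x => G.dist a x < m) ∪ univ.filter fun x => G.dist a x = m := by
          intro x
          simp only [mem_filter, mem_univ, true_and, mem_union]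
          omega
        have := (Finset.card_le_card hsub).trans (Finset.card_union_le _ _)
        omega
  intro x y hxy
  rcases hk : G.dist a x with _ | k
  · rw [hk] at hxy
    rw [← hG.connected.dist_eq_zero_iff.1 hk, ← hG.connected.dist_eq_zero_iff.1 hxy.symm]
  · have hlt : k + 1 < d := by
      have := dist_lt_card (G := G) (H := G) (B := univ) le_rfl (by
        ext u v
        exact iff_of_true (hG.connected.preconnected u v) (sideSetoid_rel.2 (by simp))) (mem_univ a) (mem_univ x)
      rwa [hk, card_univ, Fintype.card_fin] at this
    obtain ⟨-, H, hHG, hH⟩ := hball (k + 1) (by omega) hlt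
    obtain ⟨u, hu, hu'⟩ := exists_adj_dist hG.connected hk
    obtain ⟨v, hv, hv'⟩ := exists_adj_dist hG.connected (hxy ▸ hk)
    exact leaving_edge_unique hG hHG hH (by simp [hu']) (by simp [hv']) (by simp [hk])
      (by simp [← hxy, hk]) hu hv

lemma exists_iso_pathG {G : SimpleGraph (Fin d)} (hG : G.IsTree) {a : Fin d}
    (h : Function.Injective (G.dist a)) : ∃ ψ : G ≃g PathG d, (ψ a : ℕ) = d - 1 := by
  have hlt : ∀ x, G.dist a x < d := by
    intro x
    obtain ⟨p, hp, hl⟩ := (hG.connected.preconnected a x).exists_path_of_dist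
    have := hp.length_lt
    rw [Fintype.card_fin] at this
    omega
  let f : Fin d → Fin d := fun x => ⟨d - 1 - G.dist a x, by have := hlt x; omega⟩
  have hf : Function.Injective f := by
    intro x y hxy
    have hx := hlt x
    have hy := hlt y
    simp only [f, Fin.mk.injEq] at hxy
    exact h (by omega)
  refine ⟨⟨Equiv.ofBijective f (Finite.injective_iff_bijective.1 hf), ?_⟩, ?_⟩
  · intro x y
    have hx := hlt x
    have hy := hlt y
    simp only [Equiv.ofBijective_apply, PathG, SimpleGraph.fromRel_adj, f, ne_eq, Fin.mk.injEq]
    have key : ∀ u v, G.dist a v = G.dist a u + 1 → G.Adj u v := by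
      intro u v huv
      obtain ⟨z, hz, hz'⟩ := exists_adj_dist hG.connected huv
      rwa [← h hz']
    constructor
    · rintro ⟨h1, h2 | h2⟩
      · exact (key y x (by omega)).symm
      · exact key x y (by omega)
    · intro hxy
      have hne : G.dist a x ≠ G.dist a y := fun he => hxy.ne (h he)
      have h1 := hG.connected.dist_triangle (u := a) (v := x) (w := y)
      have h2 := hG.connected.dist_triangle (u := a) (v := y) (w := x)
      have h3 := SimpleGraph.dist_eq_one_iff_adj.2 hxy
      have h4 := SimpleGraph.dist_eq_one_iff_adj.2 hxy.symm
      omega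
  · simp [f]

lemma classCard_comap (r : Setoid (Fin d)) (g : Equiv.Perm (Fin d)) (x : Fin d) :
    classCard (r.comap g) x = classCard r (g x) :=
  Finset.card_equiv g fun y => by simp [Setoid.comap_rel]

lemma sameType_comap {a : Fin d} (r : Setoid (Fin d)) {g : Equiv.Perm (Fin d)} (hg : g a = a) :
    SameType a (r.comap g) r := by
  refine ⟨by rw [classCard_comap, hg], fun k => Finset.card_equiv g fun x => ?_⟩
  simp [Setoid.comap_rel, classCard_comap, hg]

lemma eRel_comp (r : Setoid (Fin d)) (g : Equiv.Perm (Fin d)) (w : NCWord d) :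
    eRel r (w ∘ g) = eRel (r.comap g.symm) w := by
  rw [eRel_apply_eq, eRel_apply_eq]
  refine if_congr ?_ rfl rfl
  refine g.forall_congr fun j => g.forall_congr fun k => ?_
  simp [Setoid.comap_rel]

lemma sub_comp_perm_mem_Ksub {a : Fin d} {g : Equiv.Perm (Fin d)} (hg : g a = a) {f : Md d}
    (hf : f ∈ Submodule.span ℚ (Set.range (eRel : Setoid (Fin d) → Md d))) :
    f - (fun w => f (w ∘ g)) ∈ Ksub a := by
  have hle : Submodule.span ℚ (Set.range (eRel : Setoid (Fin d) → Md d)) ≤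
      (Ksub a).comap (LinearMap.id - LinearMap.funLeft ℚ ℚ fun w : NCWord d => w ∘ g) := by
    rw [Submodule.span_le]
    rintro _ ⟨r, rfl⟩
    have : (LinearMap.id - LinearMap.funLeft ℚ ℚ fun w : NCWord d => w ∘ g : Md d →ₗ[ℚ] Md d)
        (eRel r) =
          -(eRel (r.comap g.symm) - eRel r) := by
      ext w
      simp [LinearMap.funLeft_apply, eRel_comp]
    rw [SetLike.mem_coe, Submodule.mem_comap, this]
    exact neg_mem (eRel_sub_mem_Ksub (sameType_comap r (by rw [Equiv.symm_apply_eq, hg])))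
  exact hle hf

/-- `f` is congruent modulo `Ksub a` to a nonnegative combination of the functions `eRel r`. -/
def EPosMod (a : Fin d) (f : Md d) : Prop :=
  ∃ c : Setoid (Fin d) → ℚ, (∀ r, 0 ≤ c r) ∧ f - ∑ r, c r • eRel r ∈ Ksub a

lemma EPosMod.add {a : Fin d} {f g : Md d} (hf : EPosMod a f) (hg : EPosMod a g) :
    EPosMod a (f + g) := by
  obtain ⟨c, hc, hf⟩ := hf
  obtain ⟨c', hc', hg⟩ := hg
  refine ⟨c + c', fun r => add_nonneg (hc r) (hc' r), ?_⟩
  convert add_mem hf hg using 1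
  simp only [Pi.add_apply, add_smul, Finset.sum_add_distrib]
  abel

lemma EPosMod.smul {a : Fin d} {f : Md d} (hf : EPosMod a f) {q : ℚ} (hq : 0 ≤ q) :
    EPosMod a (q • f) := by
  obtain ⟨c, hc, hf⟩ := hf
  refine ⟨q • c, fun r => mul_nonneg hq (hc r), ?_⟩
  convert Submodule.smul_mem _ q hf using 1
  simp only [Pi.smul_apply, smul_sub, Finset.smul_sum, smul_assoc]

lemma EPosMod.of_sub_mem {a : Fin d} {f g : Md d} (hg : EPosMod a g) (h : f - g ∈ Ksub a) :
    EPosMod a f := by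
  obtain ⟨c, hc, hg⟩ := hg
  refine ⟨c, hc, ?_⟩
  convert add_mem h hg using 1
  abel

lemma ePosMod_eRel (a : Fin d) (r : Setoid (Fin d)) : EPosMod a (eRel r) := by
  refine ⟨Pi.single r 1, fun s => ?_, ?_⟩
  · by_cases h : s = r
    · subst h; simp
    · simp [h]
  · rw [Finset.sum_eq_single r (fun s _ hs => by simp [hs]) (by simp)]
    simp

lemma ePosMod_sum {ι : Type*} (s : Finset ι) {a : Fin d} {f : ι → Md d}
    (h : ∀ i ∈ s, EPosMod a (f i)) : EPosMod a (∑ i ∈ s, f i) := by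
  induction s using Finset.induction_on with
  | empty => exact ⟨0, fun _ => le_rfl, by simp⟩
  | insert i s hi ih =>
    rw [Finset.sum_insert hi]
    exact (h i (mem_insert_self i s)).add (ih fun j hj => h j (mem_insert_of_mem hj))

variable {n : ℕ}

/-- Multiply by the indicator that the new last letter differs from the `j`-th letter. -/
def extendAt (j : Fin (n + 1)) : Md (n + 1) →ₗ[ℚ] Md (n + 2) where
  toFun f w := if w (Fin.last (n + 1)) ≠ w j.castSucc then f (w ∘ Fin.castSucc) else 0
  map_add' f g := by ext w; simp only [Pi.add_apply]; split_ifs <;> simp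
  map_smul' q f := by ext w; simp

lemma extendAt_apply (j : Fin (n + 1)) (f : Md (n + 1)) (w : NCWord (n + 2)) :
    extendAt j f w = if w (Fin.last (n + 1)) ≠ w j.castSucc then f (w ∘ Fin.castSucc) else 0 :=
  rfl

/-- The new last element joins the class of the old last element. -/
def joinLast (r : Setoid (Fin (n + 1))) : Setoid (Fin (n + 2)) :=
  r.comap ((Fin.last n).predAbove)

/-- The new last element forms a class of its own. -/
def splitLast (r : Setoid (Fin (n + 1))) : Setoid (Fin (n + 2)) :=
  isolate (joinLast r) (Fin.last (n + 1))

section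

variable (r : Setoid (Fin (n + 1))) (x y : Fin (n + 1))

variable {r} in
lemma joinLast_rel {u v : Fin (n + 2)} :
    joinLast r u v ↔ r ((Fin.last n).predAbove u) ((Fin.last n).predAbove v) := Iff.rfl

variable {r} in
lemma splitLast_rel {u v : Fin (n + 2)} : splitLast r u v ↔
    u = v ∨ (u ≠ Fin.last (n + 1) ∧ v ≠ Fin.last (n + 1) ∧ joinLast r u v) := Iff.rfl

lemma joinLast_castSucc : joinLast r x.castSucc y.castSucc ↔ r x y := by
  simp [joinLast_rel]

lemma joinLast_last_left : joinLast r (Fin.last (n + 1)) y.castSucc ↔ r (Fin.last n) y := by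
  simp [joinLast_rel]

lemma joinLast_last_right : joinLast r x.castSucc (Fin.last (n + 1)) ↔ r x (Fin.last n) := by
  simp [joinLast_rel]

lemma splitLast_castSucc : splitLast r x.castSucc y.castSucc ↔ r x y := by
  simp only [splitLast_rel, joinLast_castSucc, ne_eq, Fin.castSucc_ne_last,
    not_false_eq_true, true_and, Fin.castSucc_inj, or_iff_right_iff_imp]
  rintro rfl
  exact r.refl _

lemma not_splitLast_last_left : ¬ splitLast r (Fin.last (n + 1)) y.castSucc := by
  simp [splitLast_rel, (Fin.castSucc_ne_last y).symm]

lemma not_splitLast_last_right : ¬ splitLast r x.castSucc (Fin.last (n + 1)) := by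
  simp [splitLast_rel]

lemma classCard_joinLast_last :
    classCard (joinLast r) (Fin.last (n + 1)) = classCard r (Fin.last n) + 1 := by
  simp only [classCard, Finset.card_filter, Fin.sum_univ_castSucc (n := n + 1),
    joinLast_last_left, if_pos ((joinLast r).refl _)]

lemma classCard_splitLast_last : classCard (splitLast r) (Fin.last (n + 1)) = 1 := by
  simp only [classCard, Finset.card_filter, Fin.sum_univ_castSucc (n := n + 1),
    not_splitLast_last_left, if_pos ((splitLast r).refl _), if_false, Finset.sum_const_zero]

lemma classCard_joinLast_castSucc (h : ¬ r (Fin.last n) x) :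
    classCard (joinLast r) x.castSucc = classCard r x := by
  simp only [classCard, Finset.card_filter, Fin.sum_univ_castSucc (n := n + 1),
    joinLast_castSucc, joinLast_last_right, if_neg fun h' => h (r.symm h'), add_zero]

lemma classCard_splitLast_castSucc : classCard (splitLast r) x.castSucc = classCard r x := by
  simp only [classCard, Finset.card_filter, Fin.sum_univ_castSucc (n := n + 1),
    splitLast_castSucc, not_splitLast_last_right, if_false, add_zero]

lemma outerCount_joinLast (k : ℕ) :
    outerCount (joinLast r) (Fin.last (n + 1)) k = outerCount r (Fin.last n) k := by
  rw [outerCount, Finset.card_filter, Fin.sum_univ_castSucc (n := n + 1),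
    if_neg (by simp), add_zero, outerCount, Finset.card_filter]
  refine Finset.sum_congr rfl fun x _ => if_congr ?_ rfl rfl
  rw [joinLast_last_left]
  exact and_congr_right fun h => by rw [classCard_joinLast_castSucc r x h]

lemma classCard_congr {r : Setoid (Fin d)} {x y : Fin d} (h : r x y) :
    classCard r x = classCard r y := by
  refine congrArg Finset.card (Finset.filter_congr fun z _ => ?_)
  exact ⟨fun h' => r.trans (r.symm h) h', fun h' => r.trans h h'⟩

lemma outerCount_splitLast (k : ℕ) :
    outerCount (splitLast r) (Fin.last (n + 1)) k = outerCount r (Fin.last n) k +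
      if classCard r (Fin.last n) = k then k else 0 := by
  have h1 : outerCount (splitLast r) (Fin.last (n + 1)) k = #{x | classCard r x = k} := by
    rw [outerCount, Finset.card_filter, Fin.sum_univ_castSucc (n := n + 1),
      if_neg (by simp), add_zero, Finset.card_filter]
    refine Finset.sum_congr rfl fun x _ => if_congr ?_ rfl rfl
    rw [classCard_splitLast_castSucc, and_iff_right (not_splitLast_last_left r x)]
  have h2 : #{x | r (Fin.last n) x ∧ classCard r x = k} =
      if classCard r (Fin.last n) = k then k else 0 := by
    split_ifs with h
    · refine Eq.trans (congrArg Finset.card (Finset.filter_congr fun x _ => ?_)) h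
      exact and_iff_left_of_imp fun hx => by rw [← classCard_congr hx, h]
    · rw [Finset.card_eq_zero, Finset.filter_eq_empty_iff]
      rintro x - ⟨hx, hk⟩
      exact h (by rw [classCard_congr hx, hk])
  rw [h1, ← h2, outerCount, ← Finset.card_filter_add_card_filter_not (fun x => r (Fin.last n) x),
    add_comm, Finset.filter_filter, Finset.filter_filter]
  simp only [and_comm]

end

lemma SameType.joinLast {r s : Setoid (Fin (n + 1))} (h : SameType (Fin.last n) r s) :
    SameType (Fin.last (n + 1)) (joinLast r) (joinLast s) :=
  ⟨by rw [classCard_joinLast_last, classCard_joinLast_last, h.1],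
    fun k => by rw [outerCount_joinLast, outerCount_joinLast, h.2]⟩

lemma SameType.splitLast {r s : Setoid (Fin (n + 1))} (h : SameType (Fin.last n) r s) :
    SameType (Fin.last (n + 1)) (splitLast r) (splitLast s) :=
  ⟨by rw [classCard_splitLast_last, classCard_splitLast_last],
    fun k => by rw [outerCount_splitLast, outerCount_splitLast, h.1, h.2]⟩

lemma eRel_splitLast (r : Setoid (Fin (n + 1))) (w : NCWord (n + 2)) :
    eRel (splitLast r) w = eRel r (w ∘ Fin.castSucc) := by
  rw [eRel_apply_eq, eRel_apply_eq]
  refine if_congr ?_ rfl rfl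
  simp only [Fin.forall_fin_succ' (n := n + 1), splitLast_castSucc, not_splitLast_last_left,
    not_splitLast_last_right, ne_eq, Fin.castSucc_inj, Function.comp_apply, not_true_eq_false,
    false_imp_iff, imp_true_iff, and_true]

lemma sum_extendAt_eRel (r : Setoid (Fin (n + 1))) :
    ∑ j with r (Fin.last n) j, extendAt j (eRel r) =
      ((classCard r (Fin.last n) : ℚ) - 1) • eRel (splitLast r) + eRel (joinLast r) := by
  ext w
  have h := eRel_eq_isolate (joinLast r) (Fin.last (n + 1)) w
  rw [Finset.sum_filter, Fin.sum_univ_castSucc (n := n + 1)] at h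
  simp only [ne_eq, Fin.castSucc_ne_last, not_false_eq_true, true_and, joinLast_last_left,
    not_true_eq_false, false_and, if_false, add_zero] at h
  rw [Pi.add_apply, h, Pi.smul_apply, smul_eq_mul, ← splitLast, Finset.sum_apply]
  have h' : ∀ j, extendAt j (eRel r) w = eRel (splitLast r) w *
      (1 - if w (Fin.last (n + 1)) = w j.castSucc then 1 else 0) := by
    intro j
    rw [extendAt_apply, eRel_splitLast]
    split_ifs <;> simp_all
  simp only [h', ← Finset.mul_sum, Finset.sum_sub_distrib, Finset.sum_const, nsmul_eq_mul,
    mul_one, ← Finset.sum_filter, classCard]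
  ring

lemma eRel_comp_swap {r : Setoid (Fin d)} {x y : Fin d} (h : r x y) (w : NCWord d) :
    eRel r (w ∘ Equiv.swap x y) = eRel r w := by
  rw [eRel_comp]
  congr 1
  have hs : ∀ u, r (Equiv.swap x y u) u := by
    intro u
    by_cases hx : u = x
    · subst hx; simpa using r.symm h
    by_cases hy : u = y
    · subst hy; simpa using h
    rw [Equiv.swap_apply_of_ne_of_ne hx hy]
  ext u v
  rw [Setoid.comap_rel, Equiv.symm_swap]
  exact ⟨fun h' => r.trans (r.symm (hs u)) (r.trans h' (hs v)),
    fun h' => r.trans (hs u) (r.trans h' (r.symm (hs v)))⟩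

lemma extendAt_comp_swap {r : Setoid (Fin (n + 1))} {j : Fin (n + 1)} (h : r (Fin.last n) j) :
    (fun w => extendAt (Fin.last n) (eRel r)
      (w ∘ Equiv.swap (Fin.last n).castSucc j.castSucc)) = extendAt j (eRel r) := by
  ext w
  have hc : (w ∘ Equiv.swap (Fin.last n).castSucc j.castSucc) ∘ Fin.castSucc =
      (w ∘ Fin.castSucc) ∘ Equiv.swap (Fin.last n) j := by
    ext i
    simp only [Function.comp_apply]
    rw [← (Fin.castSucc_injective (n + 1)).swap_apply]
  rw [extendAt_apply, extendAt_apply, hc, eRel_comp_swap h]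
  simp only [Function.comp_apply, Equiv.swap_apply_left]
  rw [Equiv.swap_apply_of_ne_of_ne (Fin.castSucc_ne_last _).symm (Fin.castSucc_ne_last _).symm]

lemma extendAt_eRel_mem_span (r : Setoid (Fin (n + 1))) (j : Fin (n + 1)) :
    extendAt j (eRel r) ∈ Submodule.span ℚ (Set.range (eRel : Setoid (Fin (n + 2)) → _)) := by
  obtain ⟨G, hG⟩ : ∃ G : SimpleGraph (Fin (n + 2)), ∀ x y, G.Adj x y ↔ x ≠ y ∧
      ((splitLast r x y ∨ (x = Fin.last (n + 1) ∧ y = j.castSucc)) ∨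
        (splitLast r y x ∨ (y = Fin.last (n + 1) ∧ x = j.castSucc))) :=
    ⟨SimpleGraph.fromRel fun x y => splitLast r x y ∨ (x = Fin.last (n + 1) ∧ y = j.castSucc),
      SimpleGraph.fromRel_adj _⟩
  convert YG_mem_span G using 1
  ext w
  rw [extendAt_apply, ← eRel_splitLast, eRel_apply_eq, ← ite_and]
  refine if_congr ?_ rfl rfl
  simp only [hG]
  constructor
  · rintro ⟨h1, h2⟩ u v ⟨huv, (h | ⟨rfl, rfl⟩) | (h | ⟨rfl, rfl⟩)⟩
    · exact h2 u v huv h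
    · exact h1
    · exact (h2 v u huv.symm h).symm
    · exact h1.symm
  · intro h
    exact ⟨h _ _ ⟨(Fin.castSucc_ne_last j).symm, Or.inl (Or.inr ⟨rfl, rfl⟩)⟩,
      fun u v huv hr => h u v ⟨huv, Or.inl (Or.inl hr)⟩⟩

lemma classCard_pos (r : Setoid (Fin d)) (x : Fin d) : 0 < classCard r x :=
  Finset.card_pos.2 ⟨x, by simp⟩

lemma extendAt_eRel_sub_mem (r : Setoid (Fin (n + 1))) :
    extendAt (Fin.last n) (eRel r) - (classCard r (Fin.last n) : ℚ)⁻¹ •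
      (((classCard r (Fin.last n) : ℚ) - 1) • eRel (splitLast r) + eRel (joinLast r)) ∈
      Ksub (Fin.last (n + 1)) := by
  have hb : (classCard r (Fin.last n) : ℚ) ≠ 0 := Nat.cast_ne_zero.2 (classCard_pos _ _).ne'
  have h : ∑ j with r (Fin.last n) j, (extendAt (Fin.last n) (eRel r) - extendAt j (eRel r)) ∈
      Ksub (Fin.last (n + 1)) := by
    refine Submodule.sum_mem _ fun j hj => ?_
    rw [← extendAt_comp_swap (mem_filter.1 hj).2]
    exact sub_comp_perm_mem_Ksub (Equiv.swap_apply_of_ne_of_ne (Fin.castSucc_ne_last _).symm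
      (Fin.castSucc_ne_last _).symm) (extendAt_eRel_mem_span r _)
  rw [Finset.sum_sub_distrib, sum_extendAt_eRel, Finset.sum_const, ← Nat.cast_smul_eq_nsmul ℚ] at h
  convert Submodule.smul_mem _ (classCard r (Fin.last n) : ℚ)⁻¹ h using 1
  rw [smul_sub, ← classCard, inv_smul_smul₀ hb]

lemma extendAt_mem_Ksub {f : Md (n + 1)} (hf : f ∈ Ksub (Fin.last n)) :
    extendAt (Fin.last n) f ∈ Ksub (Fin.last (n + 1)) := by
  suffices h : Ksub (Fin.last n) ≤ (Ksub (Fin.last (n + 1))).comap (extendAt (Fin.last n)) from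
    h hf
  rw [Ksub_eq_span, Submodule.span_le]
  rintro _ ⟨r, s, h, rfl⟩
  have h1 := extendAt_eRel_sub_mem r
  have h2 := extendAt_eRel_sub_mem s
  have h3 := Submodule.smul_mem _ (classCard s (Fin.last n) : ℚ)⁻¹
    (add_mem (Submodule.smul_mem _ ((classCard s (Fin.last n) : ℚ) - 1)
      (eRel_sub_mem_Ksub h.splitLast)) (eRel_sub_mem_Ksub h.joinLast))
  rw [h.1] at h1
  rw [SetLike.mem_coe, Submodule.mem_comap, map_sub]
  convert add_mem (sub_mem h1 h2) h3 using 1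
  module

lemma EPosMod.extendAt {f : Md (n + 1)} (hf : EPosMod (Fin.last n) f) :
    EPosMod (Fin.last (n + 1)) (extendAt (Fin.last n) f) := by
  obtain ⟨c, hc, hf⟩ := hf
  have h := extendAt_mem_Ksub hf
  rw [map_sub, map_sum] at h
  refine EPosMod.of_sub_mem (ePosMod_sum _ fun r _ => ?_) h
  rw [map_smul]
  refine EPosMod.smul (EPosMod.of_sub_mem ?_ (extendAt_eRel_sub_mem r)) (hc r)
  have hb : (1 : ℚ) ≤ classCard r (Fin.last n) := Nat.one_le_cast.2 (classCard_pos _ _)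
  exact (((ePosMod_eRel _ _).smul (sub_nonneg.2 hb)).add (ePosMod_eRel _ _)).smul (by positivity)

lemma extendAt_YG_pathG (n : ℕ) :
    extendAt (Fin.last n) (YG (PathG (n + 1))) = YG (PathG (n + 2)) := by
  ext w
  rw [extendAt_apply, YG, YG, ← ite_and]
  refine if_congr ?_ rfl rfl
  simp only [PathG, SimpleGraph.fromRel_adj]
  constructor
  · rintro ⟨h1, h2⟩ u v
    induction u using Fin.lastCases with
    | last =>
      induction v using Fin.lastCases with
      | last => simp
      | cast v =>
        rintro ⟨-, h⟩
        obtain rfl : v = Fin.last n := by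
          ext
          simp only [Fin.val_castSucc, Fin.val_last] at h ⊢
          omega
        exact h1
    | cast u =>
      induction v using Fin.lastCases with
      | last =>
        rintro ⟨-, h⟩
        obtain rfl : u = Fin.last n := by
          ext
          simp only [Fin.val_castSucc, Fin.val_last] at h ⊢
          omega
        exact h1.symm
      | cast v =>
        rintro ⟨hne, h⟩
        exact h2 u v ⟨fun h' => hne (by rw [h']), h⟩
  · intro h
    exact ⟨h _ _ ⟨(Fin.castSucc_ne_last _).symm, Or.inr rfl⟩,
      fun u v ⟨hne, huv⟩ => h _ _ ⟨fun h' => hne (Fin.castSucc_injective _ h'), huv⟩⟩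

lemma ePosMod_YG_pathG (n : ℕ) : EPosMod (Fin.last n) (YG (PathG (n + 1))) := by
  induction n with
  | zero =>
    convert ePosMod_eRel (Fin.last 0) ⊥ using 1
    have : Subsingleton (Fin (0 + 1)) := Fin.subsingleton_one
    ext w
    rw [eRel_apply_eq, YG]
    refine if_congr ?_ rfl rfl
    refine iff_of_true (fun j k h => ?_) fun j k h => (h (Subsingleton.elim _ _)).elim
    exact (h.ne (Subsingleton.elim _ _)).elim
  | succ n ih =>
    rw [← extendAt_YG_pathG]
    exact ih.extendAt

theorem stmt17 {V : Type} [Fintype V] [DecidableEq V] (T : SimpleGraph V)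
    (hT : T.IsTree) (v : V)
    (d : ℕ) (hd : 1 ≤ d) (hcard : Fintype.card V = d) :
    (∃ φ : V ≃ Fin d, φ v = (⟨d - 1, by omega⟩ : Fin d) ∧
        IsEPosNCAt (SimpleGraph.comap φ.symm T) (⟨d - 1, by omega⟩ : Fin d)) ↔
      (∃ ψ : T ≃g PathG d, ψ v = (⟨d - 1, by omega⟩ : Fin d)) := by
  constructor
  · rintro ⟨φ, hφ, h⟩
    let e : T ≃g SimpleGraph.comap φ.symm T := ⟨φ, by simp⟩
    have hG : (SimpleGraph.comap φ.symm T).IsTree := e.isTree_iff.1 hT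
    obtain ⟨ψ, hψ⟩ := exists_iso_pathG hG
      (dist_injective hG fun m hm0 hm => exists_side hG h hm0 hm)
    refine ⟨e.trans ψ, Fin.ext ?_⟩
    rw [RelIso.trans_apply, show e v = _ from hφ]
    exact hψ
  · rintro ⟨ψ, hψ⟩
    refine ⟨ψ.toEquiv, hψ, ?_⟩
    have hG : SimpleGraph.comap ψ.toEquiv.symm T = PathG d := by
      ext x y
      exact ψ.symm.map_adj_iff
    rw [hG]
    obtain ⟨n, rfl⟩ : ∃ n, d = n + 1 := ⟨d - 1, by omega⟩
    exact isEPosNCAt_iff.2 (ePosMod_YG_pathG n)
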